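/- arXiv:1809.08643 — 3 statements merged into one kernel-verified Lean document; each statement's English description precedes it below -/
import Mathlib

section
/- Let X : ℝ → ℝ² be a smooth embedded curve parametrised with unit tangent τ, with ∫_ℝ |κ| ds < ∞ and total curvature α = ∫_ℝ κ ds. Then sup_{p<q} θ(p,q) ≤ α − 2·inf_{p<q} θ(p,q). -/
open Real MeasureTheory Set Filter
open scoped RealInnerProductSpace

noncomputable section

abbrev E2 : Type := EuclideanSpace ℝ (Fin 2)

def Jrot (w : E2) : E2 := (EuclideanSpace.equiv (Fin 2) ℝ).symm ![w 1, -(w 0)]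

/-- A smooth regular plane curve parametrised over `ℝ`, with length element
`v = |dX/dp|`, unit tangent `τ = v⁻¹ dX/dp`, outward unit normal
`ν = (τ₂, -τ₁)` and curvature `κ` defined by `dτ/ds = -κν`, `d/ds = v⁻¹ d/dp`. -/
structure PlaneCurve where
  X : ℝ → E2
  v : ℝ → ℝ
  κ : ℝ → ℝ
  smooth : ContDiff ℝ (⊤ : ℕ∞) X
  v_def : ∀ p, v p = ‖deriv X p‖
  v_pos : ∀ p, 0 < v p
  κ_def : ∀ p, deriv (fun r => (v r)⁻¹ • deriv X r) p
      = (-(κ p) * v p) • Jrot ((v p)⁻¹ • deriv X p)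

namespace PlaneCurve

variable (C : PlaneCurve)

/-- Unit tangent vector. -/
def τ (p : ℝ) : E2 := (C.v p)⁻¹ • deriv C.X p

/-- Outward unit normal `ν = (τ₂, -τ₁)`. -/
def ν (p : ℝ) : E2 := Jrot (C.τ p)

/-- Local total curvature `θ(p,q) = ∫_p^q κ ds` (signed; `θ(q,p) = -θ(p,q)`). -/
def theta (p q : ℝ) : ℝ := ∫ r in p..q, C.κ r * C.v r

/-- Extrinsic distance. -/
def dExt (p q : ℝ) : ℝ := ‖C.X q - C.X p‖

/-- Intrinsic (arclength) distance `l(p,q) = ∫_p^q v dr`. -/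
def arc (p q : ℝ) : ℝ := ∫ r in p..q, C.v r

end PlaneCurve

/-- A smooth embedded closed plane curve, parametrised over `ℝ` with period `2π`,
injective on a period and positively oriented (`∫ κ ds = 2π`). -/
structure ClosedCurve extends PlaneCurve where
  periodic : ∀ p, X (p + 2*π) = X p
  embedded : ∀ p ∈ Ico (0:ℝ) (2*π), ∀ q ∈ Ico (0:ℝ) (2*π), X p = X q → p = q
  oriented : (∫ p in (0:ℝ)..(2*π), κ p * v p) = 2*π

namespace ClosedCurve

variable (C : ClosedCurve)

/-- The length `L` of the closed curve. -/
def len : ℝ := ∫ p in (0:ℝ)..(2*π), C.v p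

/-- Local total curvature `θ(p,q) = ∫_p^q κ ds`, taken in the direction of the
parametrisation (wrapping around for `q < p`, so `θ(p,q) + θ(q,p) = 2π`). -/
def thetaC (p q : ℝ) : ℝ := (if q < p then 2*π else 0) + ∫ r in p..q, C.κ r * C.v r

/-- Arclength from `p` to `q` in the direction of the parametrisation. -/
def arcC (p q : ℝ) : ℝ := (if q < p then C.len else 0) + ∫ r in p..q, C.v r

/-- `ψ(p,q) = (L/π) sin(π l(p,q)/L)`. -/
def psi (p q : ℝ) : ℝ := (C.len / π) * Real.sin (π * C.arcC p q / C.len)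

end ClosedCurve

theorem PlaneCurve.curvature_mul_speed_eq (C : PlaneCurve) (p : ℝ) :
    C.κ p * C.v p = (C.v p)⁻¹ *
      (deriv (fun r => (C.v r)⁻¹ • deriv C.X r) p 1 * deriv C.X p 0
        - deriv (fun r => (C.v r)⁻¹ • deriv C.X r) p 0 * deriv C.X p 1) := by
  have hsq : deriv C.X p 0 ^ 2 + deriv C.X p 1 ^ 2 = C.v p ^ 2 := by
    rw [C.v_def, EuclideanSpace.norm_sq_eq]
    simp
  have hv := (C.v_pos p).ne'
  rw [C.κ_def]
  simp only [Jrot, PiLp.smul_apply, smul_eq_mul, PiLp.continuousLinearEquiv_symm_apply,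
    Matrix.cons_val_zero, Matrix.cons_val_one]
  field_simp
  linear_combination -(C.κ p) * hsq

theorem PlaneCurve.measurable_curvature_mul_speed (C : PlaneCurve) :
    Measurable (fun p => C.κ p * C.v p) := by
  have hv : Measurable C.v := by
    rw [show C.v = fun p => ‖deriv C.X p‖ from funext C.v_def]
    exact (measurable_deriv C.X).norm
  have hcoord (f : ℝ → E2) (i : Fin 2) : Measurable (fun p => deriv f p i) :=
    (EuclideanSpace.proj (𝕜 := ℝ) i).continuous.measurable.comp (measurable_deriv f)
  simp_rw [C.curvature_mul_speed_eq]
  exact hv.inv.mul (((hcoord _ 1).mul (hcoord _ 0)).sub ((hcoord _ 0).mul (hcoord _ 1)))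

/-- If every integral of `f` over a bounded interval is at least `m`, then the integral of `f` over
any `(p, q]` exceeds the integral over the line by at most `-2m`. -/
theorem intervalIntegral_le_integral_sub_two_mul {f : ℝ → ℝ} (hf : Integrable f) {m : ℝ}
    (hm : ∀ a b, a < b → m ≤ ∫ x in a..b, f x) (p q : ℝ) :
    ∫ x in p..q, f x ≤ (∫ x, f x) - 2 * m := by
  have hleft : m ≤ ∫ x in Iic p, f x :=
    ge_of_tendsto (intervalIntegral_tendsto_integral_Iic p hf.integrableOn tendsto_id)
      ((eventually_lt_atBot p).mono fun a ha => hm a p ha)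
  have hright : m ≤ ∫ x in Ioi q, f x :=
    ge_of_tendsto (intervalIntegral_tendsto_integral_Ioi q hf.integrableOn tendsto_id)
      ((eventually_gt_atTop q).mono fun b hb => hm q b hb)
  have hsplit : (∫ x in Iic q, f x) + ∫ x in Ioi q, f x = ∫ x, f x :=
    intervalIntegral.integral_Iic_add_Ioi hf.integrableOn hf.integrableOn
  have hsub : (∫ x in Iic q, f x) - ∫ x in Iic p, f x = ∫ x in p..q, f x :=
    intervalIntegral.integral_Iic_sub_Iic hf.integrableOn hf.integrableOn
  linarith

/-- Lemma: bound on local total curvature for entire curves.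
For a smooth embedded curve `X : ℝ → ℝ²` with `∫_ℝ |κ| ds < ∞` and total
curvature `α = ∫_ℝ κ ds`, one has `sup_{p<q} θ(p,q) ≤ α - 2·inf_{p<q} θ(p,q)`. -/
theorem sup_theta_le_alpha_sub_two_inf_theta (C : PlaneCurve)
    (hemb : Function.Injective C.X)
    (hint : Integrable (fun p => |C.κ p| * C.v p)) :
    sSup {x : ℝ | ∃ p q : ℝ, p < q ∧ C.theta p q = x}
      ≤ (∫ p : ℝ, C.κ p * C.v p)
        - 2 * sInf {x : ℝ | ∃ p q : ℝ, p < q ∧ C.theta p q = x} := by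
  have hf : Integrable (fun p => C.κ p * C.v p) :=
    hint.mono C.measurable_curvature_mul_speed.aestronglyMeasurable
      (Eventually.of_forall fun p => by simp)
  have hbdd : BddBelow {x : ℝ | ∃ p q : ℝ, p < q ∧ C.theta p q = x} := by
    refine ⟨-∫ r, ‖C.κ r * C.v r‖, ?_⟩
    rintro _ ⟨p, q, -, rfl⟩
    have hle : |C.theta p q| ≤ ∫ r, ‖C.κ r * C.v r‖ :=
      (intervalIntegral.norm_integral_le_integral_norm_uIoc).trans
        (setIntegral_le_integral hf.norm (Eventually.of_forall fun _ => norm_nonneg _))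
    exact (abs_le.mp hle).1
  refine csSup_le ⟨_, 0, 1, one_pos, rfl⟩ ?_
  rintro _ ⟨p, q, -, rfl⟩
  exact intervalIntegral_le_integral_sub_two_mul hf
    (fun a b hab => csInf_le hbdd ⟨a, b, hab, rfl⟩) p q
end
end

section
/- Let X : ℝ → ℝ² be a smooth embedded curve and p,q ∈ ℝ with p ≠ q. Suppose the curve crosses the straight line segment between X(p) and X(q), i.e. there is r ∉ [p,q] (for p < q) with X(r) lying on the segment from X(p) to X(q). Then the ratio d(p,q)/l(p,q) is not the infimum of d/l, i.e. there exist p',q' ∈ ℝ, p' ≠ q', with d(p',q')/l(p',q') < d(p,q)/l(p,q). -/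
open Real MeasureTheory Set Filter
open scoped RealInnerProductSpace

noncomputable section

namespace PlaneCurve

theorem intervalIntegrable_v (C : PlaneCurve) (p q : ℝ) :
    IntervalIntegrable C.v volume p q := by
  have hv : C.v = fun p => ‖deriv C.X p‖ := funext C.v_def
  rw [hv]
  exact (C.smooth.continuous_deriv (by simp)).norm.intervalIntegrable p q

theorem arc_pos (C : PlaneCurve) {p q : ℝ} (hpq : p < q) : 0 < C.arc p q :=
  intervalIntegral.intervalIntegral_pos_of_pos (C.intervalIntegrable_v p q) C.v_pos hpq

theorem arc_add_arc (C : PlaneCurve) (p q r : ℝ) : C.arc p q + C.arc q r = C.arc p r :=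
  intervalIntegral.integral_add_adjacent_intervals (C.intervalIntegrable_v p q)
    (C.intervalIntegrable_v q r)

theorem dExt_pos (C : PlaneCurve) (hemb : Function.Injective C.X) {p q : ℝ} (hpq : p < q) :
    0 < C.dExt p q :=
  norm_pos_iff.2 (sub_ne_zero.2 fun h => hpq.ne' (hemb h))

theorem dExt_add_dExt_of_mem_segment (C : PlaneCurve) {p q r : ℝ}
    (h : C.X r ∈ segment ℝ (C.X p) (C.X q)) : C.dExt p r + C.dExt r q = C.dExt p q := by
  simpa only [dExt, dist_eq_norm'] using dist_add_dist_of_mem_segment h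

end PlaneCurve

/-- Lemma: crossing chords and the ratio `d/l`.
If a smooth embedded curve `X : ℝ → ℝ²` crosses the straight line segment
between `X(p)` and `X(q)` at a point `X(r)` with `r ∉ [p,q]`, then
`d(p,q)/l(p,q)` is not the infimum of `d/l`. -/
theorem crossing_not_infimum_of_ratio (C : PlaneCurve)
    (hemb : Function.Injective C.X) (p q r : ℝ)
    (hpq : p < q) (hr : r ∉ Icc p q)
    (hseg : C.X r ∈ segment ℝ (C.X p) (C.X q)) :
    ∃ p' q' : ℝ, p' < q' ∧
      C.dExt p' q' / C.arc p' q' < C.dExt p q / C.arc p q := by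
  have hd := C.dExt_pos hemb hpq
  have hl := C.arc_pos hpq
  have hsum := C.dExt_add_dExt_of_mem_segment hseg
  have hpr : 0 ≤ C.dExt p r := norm_nonneg _
  have hrq : 0 ≤ C.dExt r q := norm_nonneg _
  rcases lt_or_ge r p with h | h
  · refine ⟨r, q, h.trans hpq, div_lt_div₀' (by linarith) ?_ hd hl⟩
    linarith [C.arc_pos h, C.arc_add_arc r p q]
  · have hqr : q < r := lt_of_not_ge fun hle => hr ⟨h, hle⟩
    refine ⟨p, r, hpq.trans hqr, div_lt_div₀' (by linarith) ?_ hd hl⟩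
    linarith [C.arc_pos hqr, C.arc_add_arc p q r]
end
end

section
/- Let Σ = X(S¹) be a smooth embedded closed curve and p,q ∈ S¹, p ≠ q, such that Σ crosses the straight line segment between X(p) and X(q), i.e. there exists r ∈ S¹, r ≠ p,q, with X(r) lying on the segment from X(p) to X(q). Then (d/ψ)(p,q) is not a global minimum of d/ψ: there exist p',q' ∈ S¹, p' ≠ q', with d(p',q')/ψ(p',q') < d(p,q)/ψ(p,q). -/
open Real MeasureTheory Set Filter
open scoped RealInnerProductSpace

noncomputable section

namespace PlaneCurve

theorem continuous_v (C : PlaneCurve) : Continuous C.v := by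
  rw [funext C.v_def]
  exact (C.smooth.continuous_deriv (by simp)).norm

theorem integral_v_pos (C : PlaneCurve) {a b : ℝ} (hab : a < b) : 0 < ∫ t in a..b, C.v t :=
  intervalIntegral.intervalIntegral_pos_of_pos (C.continuous_v.intervalIntegrable a b) C.v_pos hab

theorem arc_add (C : PlaneCurve) (a b c : ℝ) : C.arc a b + C.arc b c = C.arc a c :=
  intervalIntegral.integral_add_adjacent_intervals
    (C.continuous_v.intervalIntegrable a b) (C.continuous_v.intervalIntegrable b c)

end PlaneCurve

namespace ClosedCurve

theorem len_pos (C : ClosedCurve) : 0 < C.len := C.integral_v_pos (by positivity)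

theorem arc_lt_len (C : ClosedCurve) {a b : ℝ} (ha : 0 ≤ a) (hb : b < 2 * π) :
    C.arc a b < C.len := by
  have h₀ : 0 ≤ C.arc 0 a :=
    intervalIntegral.integral_nonneg ha fun t _ => (C.v_pos t).le
  have h₁ : 0 < C.arc b (2 * π) := C.integral_v_pos hb
  have h₂ : C.arc 0 a + C.arc a b = C.arc 0 b := C.arc_add 0 a b
  have h₃ : C.arc 0 b + C.arc b (2 * π) = C.len := C.arc_add 0 b (2 * π)
  linarith

theorem sin_arc_pos (C : ClosedCurve) {a b : ℝ} (ha : 0 ≤ a) (hab : a < b) (hb : b < 2 * π) :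
    0 < Real.sin (π * C.arc a b / C.len) := by
  have hL := C.len_pos
  have h : 0 < C.arc a b := C.integral_v_pos hab
  apply Real.sin_pos_of_pos_of_lt_pi
  · positivity
  · rw [div_lt_iff₀ hL]
    exact mul_lt_mul_of_pos_left (C.arc_lt_len ha hb) Real.pi_pos

theorem arc_symm (C : ClosedCurve) (a b : ℝ) : C.arc a b = -C.arc b a :=
  intervalIntegral.integral_symm b a

theorem sin_arc_ne_zero (C : ClosedCurve) {a b : ℝ} (ha : a ∈ Ico (0 : ℝ) (2 * π))
    (hb : b ∈ Ico (0 : ℝ) (2 * π)) (hab : a ≠ b) :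
    Real.sin (π * C.arc a b / C.len) ≠ 0 := by
  rcases lt_or_gt_of_ne hab with h | h
  · exact (C.sin_arc_pos ha.1 h hb.2).ne'
  · rw [C.arc_symm a b, mul_neg, neg_div, Real.sin_neg]
    exact neg_ne_zero.2 (C.sin_arc_pos hb.1 h ha.2).ne'

theorem psi_eq_abs_sin (C : ClosedCurve) {a b : ℝ} (ha : a ∈ Ico (0 : ℝ) (2 * π))
    (hb : b ∈ Ico (0 : ℝ) (2 * π)) (hab : a ≠ b) :
    C.psi a b = C.len / π * |Real.sin (π * C.arc a b / C.len)| := by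
  have hL := C.len_pos
  rcases lt_or_gt_of_ne hab with h | h
  · have harc : C.arcC a b = C.arc a b := by simp [arcC, PlaneCurve.arc, h.not_gt]
    rw [psi, harc, abs_of_pos (C.sin_arc_pos ha.1 h hb.2)]
  · have harc : C.arcC a b = C.len - C.arc b a := by
      rw [sub_eq_add_neg, ← C.arc_symm a b]
      simp [arcC, PlaneCurve.arc, h]
    have hsin : π * (C.len - C.arc b a) / C.len = π - π * C.arc b a / C.len := by
      field_simp
    rw [psi, harc, hsin, Real.sin_pi_sub, C.arc_symm a b, mul_neg, neg_div, Real.sin_neg, abs_neg,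
      abs_of_pos (C.sin_arc_pos hb.1 h ha.2)]

theorem psi_pos (C : ClosedCurve) {a b : ℝ} (ha : a ∈ Ico (0 : ℝ) (2 * π))
    (hb : b ∈ Ico (0 : ℝ) (2 * π)) (hab : a ≠ b) : 0 < C.psi a b := by
  rw [C.psi_eq_abs_sin ha hb hab]
  exact mul_pos (div_pos C.len_pos Real.pi_pos) (abs_pos.2 (C.sin_arc_ne_zero ha hb hab))

end ClosedCurve

theorem abs_sin_add_lt {x y : ℝ} (hx : Real.sin x ≠ 0) (hy : Real.sin y ≠ 0) :
    |Real.sin (x + y)| < |Real.sin x| + |Real.sin y| := by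
  have hcos : |Real.cos x| < 1 := by
    rw [← sq_lt_one_iff_abs_lt_one]
    have := Real.sin_sq_add_cos_sq x
    have := pow_pos (abs_pos.2 hx) 2
    rw [sq_abs] at this
    linarith
  calc |Real.sin (x + y)| ≤ |Real.sin x| * |Real.cos y| + |Real.cos x| * |Real.sin y| := by
        rw [Real.sin_add, ← abs_mul, ← abs_mul]
        exact abs_add_le _ _
    _ < |Real.sin x| + |Real.sin y| :=
        add_lt_add_of_le_of_lt (mul_le_of_le_one_right (abs_nonneg _) (Real.abs_cos_le_one y))
          (mul_lt_of_lt_one_left (abs_pos.2 hy) hcos)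

/-- Strict triangle inequality for `ψ`. -/
theorem ClosedCurve.psi_lt_add (C : ClosedCurve) {a b c : ℝ} (ha : a ∈ Ico (0 : ℝ) (2 * π))
    (hb : b ∈ Ico (0 : ℝ) (2 * π)) (hc : c ∈ Ico (0 : ℝ) (2 * π)) (hab : a ≠ b) (hbc : b ≠ c)
    (hac : a ≠ c) : C.psi a c < C.psi a b + C.psi b c := by
  rw [C.psi_eq_abs_sin ha hc hac, C.psi_eq_abs_sin ha hb hab, C.psi_eq_abs_sin hb hc hbc,
    ← mul_add, ← C.arc_add a b c, mul_add, add_div]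
  exact mul_lt_mul_of_pos_left
    (abs_sin_add_lt (C.sin_arc_ne_zero ha hb hab) (C.sin_arc_ne_zero hb hc hbc))
    (div_pos C.len_pos Real.pi_pos)

/-- Lemma: crossing chords and the ratio `d/ψ`.
If a smooth embedded closed curve crosses the straight line segment between
`X(p)` and `X(q)` (`p ≠ q`) at a third point `X(r)`, then `(d/ψ)(p,q)` is not
a global minimum of `d/ψ`. -/
theorem crossing_not_global_min_of_ratio_psi (C : ClosedCurve)
    (p : ℝ) (hp : p ∈ Ico (0:ℝ) (2*π)) (q : ℝ) (hq : q ∈ Ico (0:ℝ) (2*π)) (hpq : p ≠ q)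
    (r : ℝ) (hr : r ∈ Ico (0:ℝ) (2*π)) (hrp : r ≠ p) (hrq : r ≠ q)
    (hseg : C.X r ∈ segment ℝ (C.X p) (C.X q)) :
    ∃ p' ∈ Ico (0:ℝ) (2*π), ∃ q' ∈ Ico (0:ℝ) (2*π), p' ≠ q' ∧
      C.dExt p' q' / C.psi p' q' < C.dExt p q / C.psi p q := by
  have hdist : C.dExt p r + C.dExt r q = C.dExt p q := by
    have h := dist_add_dist_of_mem_segment hseg
    rw [dist_comm (C.X p) (C.X r), dist_comm (C.X r) (C.X q), dist_comm (C.X p) (C.X q)] at h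
    simpa only [dist_eq_norm, PlaneCurve.dExt] using h
  have hd : 0 < C.dExt p q :=
    norm_pos_iff.2 (sub_ne_zero.2 fun h => hpq (C.embedded p hp q hq h.symm))
  have hψ := C.psi_pos hp hq hpq
  by_contra! hmin
  have h₁ := hmin p hp r hr hrp.symm
  have h₂ := hmin r hr q hq hrq
  rw [le_div_iff₀ (C.psi_pos hp hr hrp.symm)] at h₁
  rw [le_div_iff₀ (C.psi_pos hr hq hrq)] at h₂
  have h₃ := mul_lt_mul_of_pos_left (C.psi_lt_add hp hr hq hrp.symm hrq hpq) (div_pos hd hψ)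
  rw [div_mul_cancel₀ _ hψ.ne', mul_add] at h₃
  linarith
end
end
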